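/- Define polynomials f_n(q,z) in two variables by f_0(q,z) = z and f_{n+1}(q,z) = f_n(q(1+z), 4qz). Then for every natural number n and every p ∈ [0,1], 1 − T_n(p) ≤ f_n(1−p, 1−p). -/

import Mathlib

open Set Filter Topology

noncomputable section

/-- The dyadic tile `[a/2^i, (a+1)/2^i] × [b/2^j, (b+1)/2^j]` as a subset of `ℝ × ℝ`. -/
def dyadicTile (i j a b : ℕ) : Set (ℝ × ℝ) :=
  Set.Icc ((a : ℝ) / 2 ^ i) (((a : ℝ) + 1) / 2 ^ i) ×ˢ
    Set.Icc ((b : ℝ) / 2 ^ j) (((b : ℝ) + 1) / 2 ^ j)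

/-- `t` is a dyadic tile of order `n` contained in the unit square. -/
def IsDyadicTile (n : ℕ) (t : Set (ℝ × ℝ)) : Prop :=
  ∃ i j a b : ℕ, i + j = n ∧ a < 2 ^ i ∧ b < 2 ^ j ∧ t = dyadicTile i j a b

/-- `F` is a tiling of the region `R` by dyadic tiles of order `n`:
a set of order-`n` tiles whose union is `R` and whose interiors are pairwise disjoint. -/
def IsTiling (n : ℕ) (F : Set (Set (ℝ × ℝ))) (R : Set (ℝ × ℝ)) : Prop :=
  (∀ t ∈ F, IsDyadicTile n t) ∧ ⋃₀ F = R ∧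
    F.Pairwise fun s t => interior s ∩ interior t = ∅

def unitSquare : Set (ℝ × ℝ) := Set.Icc (0 : ℝ) 1 ×ˢ Set.Icc (0 : ℝ) 1

/-- Index type for the dyadic tiles of order `n`: a shape `i` (width `2^{-i}`, height
`2^{-(n-i)}`) together with the horizontal and vertical positions. -/
abbrev TileIndex (n : ℕ) : Type :=
  Σ i : Fin (n + 1), Fin (2 ^ (i : ℕ)) × Fin (2 ^ (n - (i : ℕ)))

/-- The order-`n` tile corresponding to an index. -/
def tileOf (n : ℕ) (x : TileIndex n) : Set (ℝ × ℝ) :=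
  dyadicTile (x.1 : ℕ) (n - (x.1 : ℕ)) (x.2.1 : ℕ) (x.2.2 : ℕ)

/-- The set `S` of available order-`n` tiles admits a tiling of the unit square. -/
def TileableSquare (n : ℕ) (S : Finset (TileIndex n)) : Prop :=
  ∃ F : Set (Set (ℝ × ℝ)), (∀ t ∈ F, ∃ x ∈ S, t = tileOf n x) ∧ IsTiling n F unitSquare

open Classical in
/-- Probability of the event `E` when each of the `(n+1)·2^n` order-`n` dyadic tiles is
available independently with probability `p`. -/
def Pr (n : ℕ) (p : ℝ) (E : Finset (TileIndex n) → Prop) : ℝ :=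
  ∑ S : Finset (TileIndex n),
    if E S then p ^ S.card * (1 - p) ^ ((n + 1) * 2 ^ n - S.card) else 0

/-- `T n p`: the probability that some set of available order-`n` tiles tiles `[0,1]²`. -/
def T (n : ℕ) (p : ℝ) : ℝ := Pr n p (TileableSquare n)

/-- The critical probability `p_c`. -/
def pc : ℝ :=
  sInf {p : ℝ | p ∈ Set.Icc (0 : ℝ) 1 ∧ Tendsto (fun n => T n p) atTop (𝓝 1)}

/-- The two-variable polynomials `f_n`, defined by
`f_0(q,z) = z` and `f_{n+1}(q,z) = f_n(q(1+z), 4qz)`. -/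
def fpoly : ℕ → ℝ → ℝ → ℝ
  | 0, _, z => z
  | n + 1, q, z => fpoly n (q * (1 + z)) (4 * q * z)

/-- A dyadic rectangle, encoded by the binary words of its two sides
(most recently chosen half first). -/
abbrev WordTile : Type := List Bool × List Bool

namespace WordTile

/-- The order of a word tile. -/
def order (t : WordTile) : ℕ := t.1.length + t.2.length

/-- `Child t s`: the rectangle `s` is one of the four halves of `t`. -/
def Child (t s : WordTile) : Prop :=
  ∃ b : Bool, s = (b :: t.1, t.2) ∨ s = (t.1, b :: t.2)

lemma Child.order_eq {t s : WordTile} (h : Child t s) : s.order = t.order + 1 := by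
  obtain ⟨b, rfl | rfl⟩ := h <;> simp [order] <;> omega

/-- Rectangles that can be assembled from available tiles by repeatedly gluing two halves. -/
inductive Good (avail : WordTile → Prop) : WordTile → Prop
  | base {t} : avail t → Good avail t
  | splitFst {x y} : (∀ b : Bool, Good avail (b :: x, y)) → Good avail (x, y)
  | splitSnd {x y} : (∀ b : Bool, Good avail (x, b :: y)) → Good avail (x, y)

/-- `Reach avail t s`: there is a sequence of successive halvings from `t` to `s`, all of whose
members fail to be good. -/
inductive Reach (avail : WordTile → Prop) : WordTile → WordTile → Prop
  | refl {t} : ¬ Good avail t → Reach avail t t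
  | step {t u s} : ¬ Good avail t → Child t u → Reach avail u s → Reach avail t s

variable {avail : WordTile → Prop} {n : ℕ}

lemma Reach.not_good_left {t s : WordTile} (h : Reach avail t s) : ¬ Good avail t := by
  cases h <;> assumption

lemma Reach.not_good_right {t s : WordTile} (h : Reach avail t s) : ¬ Good avail s := by
  induction h with
  | refl h => exact h
  | step _ _ _ ih => exact ih

lemma Child.suffix {t s : WordTile} (h : Child t s) : t.1 <:+ s.1 ∧ t.2 <:+ s.2 := by
  obtain ⟨b, rfl | rfl⟩ := h <;> simp

lemma Reach.suffix {t s : WordTile} (h : Reach avail t s) : t.1 <:+ s.1 ∧ t.2 <:+ s.2 := by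
  induction h with
  | refl h => simp
  | step _ h _ ih => exact ⟨h.suffix.1.trans ih.1, h.suffix.2.trans ih.2⟩

lemma exists_cons_suffix {l m : List Bool} (h : l <:+ m) (hne : m ≠ l) :
    ∃ b, b :: l <:+ m := by
  obtain ⟨k, rfl⟩ := h
  rcases List.eq_nil_or_concat k with rfl | ⟨k', b, rfl⟩
  · simp at hne
  · exact ⟨b, k', by simp⟩

lemma cons_suffix_of_suffix {l m r : List Bool} {b : Bool} (hlm : l <:+ m) (hne : m ≠ l)
    (hm : m <:+ r) (hb : b :: l <:+ r) : b :: l <:+ m := by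
  refine List.suffix_of_suffix_length_le hb hm ?_
  obtain ⟨c, hc⟩ := exists_cons_suffix hlm hne
  simpa using hc.length_le

lemma Reach.exists_snd_eq {t s : WordTile} {A B : List Bool} (h : Reach avail t s)
    (hA : A <:+ t.1) (hB : t.2 <:+ B) (hs : B <:+ s.2) :
    ∃ x, A <:+ x ∧ Reach avail (x, B) s := by
  induction h with
  | refl h =>
    rename_i t
    have : B = t.2 := hs.eq_of_length_le hB.length_le
    subst this
    exact ⟨_, hA, .refl h⟩
  | step h hc hr ih =>
    rename_i t u s
    by_cases he : B = t.2
    · subst he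
      exact ⟨_, hA, .step h hc hr⟩
    · refine ih (hA.trans hc.suffix.1) ?_ hs
      obtain ⟨b, rfl | rfl⟩ := hc
      · exact hB
      · exact cons_suffix_of_suffix hB he hs hr.suffix.2

lemma Reach.exists_fst_eq {t s : WordTile} {A B : List Bool} (h : Reach avail t s)
    (hB : B <:+ t.2) (hA : t.1 <:+ A) (hs : A <:+ s.1) :
    ∃ y, B <:+ y ∧ Reach avail (A, y) s := by
  induction h with
  | refl h =>
    rename_i t
    have : A = t.1 := hs.eq_of_length_le hA.length_le
    subst this
    exact ⟨_, hB, .refl h⟩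
  | step h hc hr ih =>
    rename_i t u s
    by_cases he : A = t.1
    · subst he
      exact ⟨_, hB, .step h hc hr⟩
    · refine ih (hB.trans hc.suffix.2) ?_ hs
      obtain ⟨b, rfl | rfl⟩ := hc
      · exact cons_suffix_of_suffix hA he hs hr.suffix.1
      · exact hA

/-- If the intersection of two crossing rectangles is good, then the rectangles have no common
bad descendant of order `n`. -/
lemma Good.false_of_reach (hav : ∀ t, avail t → t.order = n) {r : WordTile} (hr : Good avail r)
    {t u s : WordTile} (hs : s.order = n) (ht : Reach avail t s) (hu : Reach avail u s)
    (h1 : r.1 <:+ t.1) (h2 : t.2 <:+ r.2) (h3 : u.1 <:+ r.1) (h4 : r.2 <:+ u.2) : False := by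
  induction hr generalizing t u with
  | base h =>
    rename_i r
    have hl : r.1 <:+ s.1 := h1.trans ht.suffix.1
    have hl' : r.2 <:+ s.2 := h4.trans hu.suffix.2
    have := hav _ h
    have e1 := hl.length_le
    have e2 := hl'.length_le
    simp only [order] at this hs
    have : r = s := Prod.ext (hl.eq_of_length (by omega)) (hl'.eq_of_length (by omega))
    exact hu.not_good_right (this ▸ .base h)
  | splitFst hg ih =>
    rename_i A B
    obtain ⟨x, hx, hxs⟩ := ht.exists_snd_eq h1 h2 (h4.trans hu.suffix.2)
    by_cases he : x = A
    · subst he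
      exact hxs.not_good_left (.splitFst hg)
    · obtain ⟨b, hb⟩ := exists_cons_suffix hx he
      exact ih b hxs hu hb (List.suffix_refl _) (h3.trans (by simp)) h4
  | splitSnd hg ih =>
    rename_i A B
    obtain ⟨y, hy, hys⟩ := hu.exists_fst_eq h4 h3 (h1.trans ht.suffix.1)
    by_cases he : y = B
    · subst he
      exact hys.not_good_left (.splitSnd hg)
    · obtain ⟨b, hb⟩ := exists_cons_suffix hy he
      exact ih b ht hys h1 (h2.trans (by simp)) (List.suffix_refl _) hb

/-- Two rectangles are separated if they have no common bad descendant of order `n`. -/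
def Sep (avail : WordTile → Prop) (n : ℕ) (t u : WordTile) : Prop :=
  ∀ s, s.order = n → Reach avail t s → ¬ Reach avail u s

lemma Sep.child_left {t t' u : WordTile} (h : Sep avail n t u) (ht : ¬ Good avail t)
    (hc : Child t t') : Sep avail n t' u :=
  fun s hs h1 h2 => h s hs (.step ht hc h1) h2

lemma Sep.child_right {t u u' : WordTile} (h : Sep avail n t u) (hu : ¬ Good avail u)
    (hc : Child u u') : Sep avail n t u' :=
  fun s hs h1 h2 => h s hs h1 (.step hu hc h2)

/-- The tiles of a flagged list from the first flag `true` onwards, that is, those which do not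
belong to the initial chain. -/
def far : List (WordTile × Bool) → List WordTile
  | [] => []
  | (_, false) :: L => far L
  | (u, true) :: L => u :: L.map Prod.fst

/-- `Bond t u`: `u` is twice as wide and half as high as `t`, and the two cross. -/
def Bond (t u : WordTile) : Prop :=
  ∃ a c : Bool, t.1 = a :: u.1 ∧ u.2 = c :: t.2

/-- The invariant of a chain forest, given as its first tile and the list of all others. The flag
`false` means that a tile is bonded to its predecessor, `true` that it starts a new chain. -/
def Valid (avail : WordTile → Prop) (n : ℕ) : WordTile → List (WordTile × Bool) → Prop
  | t, [] => ¬ Good avail t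
  | t, (u, f) :: L => ¬ Good avail t ∧ (f = false → Bond t u) ∧
      (∀ v ∈ far ((u, f) :: L), Sep avail n t v) ∧ Valid avail n u L

lemma Valid.not_good {t : WordTile} {L : List (WordTile × Bool)} (h : Valid avail n t L) :
    ¬ Good avail t := by
  cases L with
  | nil => exact h
  | cons p L => exact h.1

lemma Valid.not_good_of_mem {t : WordTile} {L : List (WordTile × Bool)} (h : Valid avail n t L) :
    ∀ u ∈ L.map Prod.fst, ¬ Good avail u := by
  induction L generalizing t with
  | nil => simp
  | cons p L ih =>
    have h' := h.2.2.2
    simp only [List.map_cons, List.mem_cons, forall_eq_or_imp]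
    exact ⟨h'.not_good, ih h'⟩

lemma Valid.sep_of_mem_far {t : WordTile} {L : List (WordTile × Bool)} (h : Valid avail n t L) :
    ∀ u ∈ far L, Sep avail n t u := by
  cases L with
  | nil => simp [far]
  | cons p L => exact h.2.2.1

lemma Valid.mem_far_or_cross {t : WordTile} {L : List (WordTile × Bool)}
    (h : Valid avail n t L) : ∀ u ∈ L.map Prod.fst,
      u ∈ far L ∨ (u.1 <:+ t.1 ∧ t.2 <:+ u.2 ∧ u.1.length < t.1.length) := by
  induction L generalizing t with
  | nil => simp
  | cons p L ih =>
    obtain ⟨u, f⟩ := p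
    have h' := h.2.2.2
    cases f with
    | true => intro v hv; left; simpa [far] using hv
    | false =>
      obtain ⟨a, c, hx, hy⟩ := h.2.1 rfl
      simp only [List.map_cons, List.mem_cons, forall_eq_or_imp]
      refine ⟨.inr ⟨by simp [hx], by simp [hy], by simp [hx]⟩, fun v hv => ?_⟩
      rcases ih h' v hv with hf | ⟨h1, h2, h3⟩
      · exact .inl hf
      · refine .inr ⟨h1.trans (by simp [hx]), List.IsSuffix.trans (by simp [hy]) h2, ?_⟩
        simp [hx]; omega

lemma Valid.nodup {t : WordTile} {L : List (WordTile × Bool)} (h : Valid avail n t L)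
    (ho : ∀ u ∈ t :: L.map Prod.fst, u.order = n) : (t :: L.map Prod.fst).Nodup := by
  induction L generalizing t with
  | nil => simp
  | cons p L ih =>
    refine List.nodup_cons.2 ⟨fun hm => ?_,
      ih h.2.2.2 fun u hu => ho u (List.mem_cons_of_mem _ hu)⟩
    rcases h.mem_far_or_cross t hm with hf | ⟨-, -, hl⟩
    · exact h.sep_of_mem_far t hf t (ho t (by simp)) (.refl h.not_good) (.refl h.not_good)
    · exact lt_irrefl _ hl

/-- The possible refinements of a chain forest with first tile `t`, without the leftmost tile. -/
def refineTail : WordTile → List (WordTile × Bool) → List (List (WordTile × Bool))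
  | t, [] => [[((t.1, false :: t.2), false)], [((t.1, true :: t.2), false)]]
  | t, (u, false) :: L =>
      (refineTail u L).flatMap fun σ =>
        [((t.1, u.2), false) :: σ,
          ((t.1, (!u.2.headD false) :: t.2), false) ::
            (((!t.1.headD false) :: u.1, u.2), true) :: σ]
  | t, (u, true) :: L =>
      (refineTail u L).flatMap fun σ =>
        [((t.1, false :: t.2), false) :: ((false :: u.1, u.2), true) :: σ,
          ((t.1, false :: t.2), false) :: ((true :: u.1, u.2), true) :: σ,
          ((t.1, true :: t.2), false) :: ((false :: u.1, u.2), true) :: σ,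
          ((t.1, true :: t.2), false) :: ((true :: u.1, u.2), true) :: σ]

/-- The possible chain forests after `n` refinements of the unit square. -/
def forests : ℕ → List (WordTile × List (WordTile × Bool))
  | 0 => [(([], []), [])]
  | n + 1 => (forests n).flatMap fun s => (refineTail s.1 s.2).flatMap fun σ =>
      [((false :: s.1.1, s.1.2), σ), ((true :: s.1.1, s.1.2), σ)]

lemma exists_not_good_fst {t : WordTile} (h : ¬ Good avail t) :
    ∃ b : Bool, ¬ Good avail (b :: t.1, t.2) := by
  by_contra! hc
  exact h (.splitFst hc)

lemma exists_not_good_snd {t : WordTile} (h : ¬ Good avail t) :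
    ∃ b : Bool, ¬ Good avail (t.1, b :: t.2) := by
  by_contra! hc
  exact h (.splitSnd hc)

lemma cons_eq_not_cons {b c : Bool} (h : b ≠ c) : b = !c := by
  cases b <;> cases c <;> simp_all

/-- Every valid chain forest has a valid refinement. -/
lemma Valid.exists_refineTail (hav : ∀ t, avail t → t.order = n) {t : WordTile}
    {L : List (WordTile × Bool)} (h : Valid avail n t L) :
    ∀ b : Bool, ¬ Good avail (b :: t.1, t.2) →
      ∃ σ ∈ refineTail t L, Valid avail n (b :: t.1, t.2) σ ∧
        (∀ s ∈ σ.map Prod.fst, ∃ v ∈ t :: L.map Prod.fst, Child v s) ∧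
        ∀ w, t.1 <:+ w.1 → w.2 <:+ t.2 →
          (∀ u ∈ far L, Sep avail n w u) → ∀ v ∈ far σ, Sep avail n w v := by
  induction L generalizing t with
  | nil =>
    intro b hb
    obtain ⟨c, hc⟩ := exists_not_good_snd h
    refine ⟨[((t.1, c :: t.2), false)], ?_, ?_, ?_, ?_⟩
    · cases c <;> simp [refineTail]
    · simp [Valid, far, Bond, hb, hc]
    · simp [Child]
    · simp [far]
  | cons p L ih =>
    obtain ⟨u, f⟩ := p
    intro b hb
    have hu := h.2.2.2
    have ht := h.not_good
    have hleft : Child t (b :: t.1, t.2) := ⟨b, .inl rfl⟩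
    -- the situation where the chain is cut between `t` and `u`
    have cut : ∀ c d : Bool, ¬ Good avail (t.1, c :: t.2) → ¬ Good avail (d :: u.1, u.2) →
        (∀ w, t.1 <:+ w.1 → w.2 <:+ t.2 → (∀ v ∈ far ((u, f) :: L), Sep avail n w v) →
          ∀ v ∈ u :: L.map Prod.fst, Sep avail n w v) →
        (∀ σ ∈ refineTail u L, ((t.1, c :: t.2), false) :: ((d :: u.1, u.2), true) :: σ ∈
          refineTail t ((u, f) :: L)) →
        ∃ σ ∈ refineTail t ((u, f) :: L), Valid avail n (b :: t.1, t.2) σ ∧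
        (∀ s ∈ σ.map Prod.fst, ∃ v ∈ t :: ((u, f) :: L).map Prod.fst, Child v s) ∧
        ∀ w, t.1 <:+ w.1 → w.2 <:+ t.2 →
          (∀ v ∈ far ((u, f) :: L), Sep avail n w v) → ∀ v ∈ far σ, Sep avail n w v := by
      intro c d hc hd hsep hmem
      obtain ⟨σ, hσ, hval, hpar, -⟩ := ih hu d hd
      have hsep' : ∀ w, t.1 <:+ w.1 → w.2 <:+ t.2 →
          (∀ v ∈ far ((u, f) :: L), Sep avail n w v) →
          ∀ v ∈ (d :: u.1, u.2) :: σ.map Prod.fst, Sep avail n w v := by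
        intro w h1 h2 h3
        have hw := hsep w h1 h2 h3
        intro v hv
        rcases List.mem_cons.1 hv with rfl | hv
        · exact (hw u (by simp)).child_right hu.not_good ⟨d, .inl rfl⟩
        · obtain ⟨v', hv', hch⟩ := hpar v hv
          refine (hw v' hv').child_right ?_ hch
          rcases List.mem_cons.1 hv' with rfl | hv'
          · exact hu.not_good
          · exact hu.not_good_of_mem _ hv'
      have hts := hsep' t (List.suffix_refl _) (List.suffix_refl _) h.sep_of_mem_far
      refine ⟨_, hmem σ hσ, ⟨hb, ?_, ?_, hc, by simp, ?_, hval⟩, ?_, ?_⟩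
      · exact fun _ => ⟨b, c, rfl, rfl⟩
      · exact fun v hv => (hts v hv).child_left ht hleft
      · exact fun v hv => (hts v hv).child_left ht ⟨c, .inr rfl⟩
      · simp only [List.map_cons, List.mem_cons, forall_eq_or_imp]
        refine ⟨⟨t, .inl rfl, c, .inr rfl⟩, ⟨u, .inr (.inl rfl), d, .inl rfl⟩, fun s hs => ?_⟩
        obtain ⟨v, hv, hch⟩ := hpar s hs
        exact ⟨v, .inr (List.mem_cons.1 hv), hch⟩
      · exact hsep'
    cases f with
    | true =>
      obtain ⟨c, hc⟩ := exists_not_good_snd ht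
      obtain ⟨d, hd⟩ := exists_not_good_fst hu.not_good
      refine cut c d hc hd (fun w _ _ h3 => h3) fun σ hσ => ?_
      simp only [refineTail, List.mem_flatMap]
      exact ⟨σ, hσ, by cases c <;> cases d <;> simp⟩
    | false =>
      obtain ⟨a, c, hx, hy⟩ := h.2.1 rfl
      by_cases hr : Good avail (t.1, u.2)
      · obtain ⟨c', hc'⟩ := exists_not_good_snd ht
        obtain ⟨d, hd⟩ := exists_not_good_fst hu.not_good
        have ec : c' = !c := cons_eq_not_cons fun e => hc' (by rw [e, ← hy]; exact hr)
        have ed : d = !a := cons_eq_not_cons fun e => hd (by rw [e, ← hx]; exact hr)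
        refine cut c' d hc' hd (fun w h1 h2 h3 v hv => ?_) fun σ hσ => ?_
        · have cross : u.1 <:+ t.1 ∧ t.2 <:+ u.2 := ⟨by simp [hx], by simp [hy]⟩
          have key : v.1 <:+ u.1 → u.2 <:+ v.2 → Sep avail n w v := fun h4 h5 s hs hws hvs =>
            hr.false_of_reach hav hs hws hvs h1 (h2.trans cross.2) (h4.trans cross.1) h5
          rcases List.mem_cons.1 hv with rfl | hv
          · exact key (List.suffix_refl _) (List.suffix_refl _)
          · rcases hu.mem_far_or_cross v hv with hf | ⟨h4, h5, -⟩
            · exact h3 v hf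
            · exact key h4 h5
        · simp only [refineTail, List.mem_flatMap]
          exact ⟨σ, hσ, by simp [hx, hy, ec, ed]⟩
      · obtain ⟨σ, hσ, hval, hpar, hfar⟩ := ih hu a (by rw [← hx]; exact hr)
        rw [← hx] at hval
        have cross : u.1 <:+ t.1 ∧ t.2 <:+ u.2 := ⟨by simp [hx], by simp [hy]⟩
        refine ⟨((t.1, u.2), false) :: σ, ?_, ⟨hb, ?_, ?_, hval⟩, ?_, ?_⟩
        · simp only [refineTail, List.mem_flatMap]
          exact ⟨σ, hσ, by simp⟩
        · exact fun _ => ⟨b, c, rfl, hy⟩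
        · exact hfar _ (cross.1.trans (by simp)) cross.2
            fun v hv => (h.sep_of_mem_far v hv).child_left ht hleft
        · simp only [List.map_cons, List.mem_cons, forall_eq_or_imp]
          refine ⟨⟨t, .inl rfl, c, .inr (by rw [hy])⟩, fun s hs => ?_⟩
          obtain ⟨v, hv, hch⟩ := hpar s hs
          exact ⟨v, .inr (List.mem_cons.1 hv), hch⟩
        · exact fun w h1 h2 h3 => hfar w (cross.1.trans h1) (h2.trans cross.2) h3

lemma exists_valid_mem_forests (hav : ∀ t, avail t → t.order = n)
    (h : ¬ Good avail ([], [])) (m : ℕ) :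
    ∃ s ∈ forests m, Valid avail n s.1 s.2 ∧ ∀ u ∈ s.1 :: s.2.map Prod.fst, u.order = m := by
  induction m with
  | zero => exact ⟨(([], []), []), by simp [forests], h, by simp [order]⟩
  | succ m ih =>
    obtain ⟨s, hs, hval, hord⟩ := ih
    obtain ⟨b, hb⟩ := exists_not_good_fst hval.not_good
    obtain ⟨σ, hσ, hval', hpar, -⟩ := hval.exists_refineTail hav b hb
    refine ⟨((b :: s.1.1, s.1.2), σ), ?_, hval', ?_⟩
    · simp only [forests, List.mem_flatMap]
      exact ⟨s, hs, σ, hσ, by cases b <;> simp⟩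
    · intro u hu
      have : ∃ v ∈ s.1 :: s.2.map Prod.fst, Child v u := by
        rcases List.mem_cons.1 hu with rfl | hu
        · exact ⟨s.1, by simp, b, .inl rfl⟩
        · exact hpar u hu
      obtain ⟨v, hv, hch⟩ := this
      rw [hch.order_eq, hord v hv]

/-- The weight of a flagged list: a factor `z` for each chain it starts, `q` for each bond. -/
def weight (q z : ℝ) (L : List (WordTile × Bool)) : ℝ :=
  (L.map fun p => if p.2 then z else q).prod

lemma weight_self (q : ℝ) (L : List (WordTile × Bool)) : weight q q L = q ^ L.length := by
  simp [weight]

lemma sum_map_flatMap {α β : Type*} (l : List α) (g : α → List β) (f : β → ℝ) :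
    ((l.flatMap g).map f).sum = (l.map fun a => ((g a).map f).sum).sum := by
  induction l with
  | nil => simp
  | cons a l ih => simp [ih]

lemma sum_weight_refineTail (q z : ℝ) (t : WordTile) (L : List (WordTile × Bool)) :
    ((refineTail t L).map (weight q z)).sum =
      2 * q * weight (q * (1 + z)) (4 * q * z) L := by
  induction L generalizing t with
  | nil => simp [refineTail, weight]; ring
  | cons p L ih =>
    obtain ⟨u, f⟩ := p
    have hsum : ∀ c : ℝ, ((refineTail u L).map fun σ => c * weight q z σ).sum =
        c * (2 * q * weight (q * (1 + z)) (4 * q * z) L) := fun c => by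
      rw [List.sum_map_mul_left, ih]
    cases f
    · rw [refineTail, sum_map_flatMap]
      have : (fun σ => (List.map (weight q z) [((t.1, u.2), false) :: σ,
          ((t.1, (!u.2.headD false) :: t.2), false) ::
            (((!t.1.headD false) :: u.1, u.2), true) :: σ]).sum) =
          fun σ => (q * (1 + z)) * weight q z σ := by
        funext σ; simp [weight]; ring
      rw [this, hsum]
      simp [weight]; ring
    · rw [refineTail, sum_map_flatMap]
      have : (fun σ => (List.map (weight q z)
          [((t.1, false :: t.2), false) :: ((false :: u.1, u.2), true) :: σ,
          ((t.1, false :: t.2), false) :: ((true :: u.1, u.2), true) :: σ,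
          ((t.1, true :: t.2), false) :: ((false :: u.1, u.2), true) :: σ,
          ((t.1, true :: t.2), false) :: ((true :: u.1, u.2), true) :: σ]).sum) =
          fun σ => (4 * q * z) * weight q z σ := by
        funext σ; simp [weight]; ring
      rw [this, hsum]
      simp [weight]; ring

/-- `f_n` is the generating function of the chain forests. -/
lemma sum_weight_forests (n : ℕ) (q z : ℝ) :
    ((forests n).map fun s => z * weight q z s.2).sum = fpoly n q z := by
  induction n generalizing q z with
  | zero => simp [forests, weight, fpoly]
  | succ n ih =>
    rw [fpoly, ← ih, forests, sum_map_flatMap]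
    congr 1
    refine List.map_congr_left fun s _ => ?_
    rw [sum_map_flatMap]
    have : (fun σ => (List.map (fun s : WordTile × List (WordTile × Bool) =>
        z * weight q z s.2) [((false :: s.1.1, s.1.2), σ), ((true :: s.1.1, s.1.2), σ)]).sum) =
        fun σ => (2 * z) * weight q z σ := by
      funext σ; simp; ring
    rw [this, List.sum_map_mul_left, sum_weight_refineTail]
    ring

/-- The number with binary digits `x`, least significant digit first. -/
def wordVal : List Bool → ℕ
  | [] => 0
  | b :: x => 2 * wordVal x + b.toNat

lemma wordVal_lt (x : List Bool) : wordVal x < 2 ^ x.length := by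
  induction x with
  | nil => simp [wordVal]
  | cons b x ih => cases b <;> simp [wordVal, pow_succ] <;> omega

lemma wordVal_injective {x y : List Bool} (hl : x.length = y.length)
    (h : wordVal x = wordVal y) : x = y := by
  induction x generalizing y with
  | nil => simpa using hl.symm
  | cons b x ih =>
    cases y with
    | nil => simp at hl
    | cons c y =>
      simp only [wordVal] at h
      have hb : b = c := by cases b <;> cases c <;> simp at h ⊢ <;> omega
      subst hb
      rw [ih (by simpa using hl) (by omega)]

/-- The rectangle encoded by a word tile. -/
def rect (t : WordTile) : Set (ℝ × ℝ) :=
  dyadicTile t.1.length t.2.length (wordVal t.1) (wordVal t.2)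

/-- The index of a word tile of order `n`; junk for other orders. -/
def index (n : ℕ) (t : WordTile) : TileIndex n :=
  ⟨Fin.ofNat (n + 1) t.1.length, Fin.ofNat _ (wordVal t.1), Fin.ofNat _ (wordVal t.2)⟩

lemma index_spec {t : WordTile} (h : t.order = n) :
    ((index n t).1 : ℕ) = t.1.length ∧ n - ((index n t).1 : ℕ) = t.2.length ∧
      ((index n t).2.1 : ℕ) = wordVal t.1 ∧ ((index n t).2.2 : ℕ) = wordVal t.2 := by
  simp only [order] at h
  have h1 : ((index n t).1 : ℕ) = t.1.length := Nat.mod_eq_of_lt (by omega)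
  have h2 : n - ((index n t).1 : ℕ) = t.2.length := by omega
  refine ⟨h1, h2, Nat.mod_eq_of_lt ?_, Nat.mod_eq_of_lt ?_⟩
  · exact (wordVal_lt t.1).trans_eq (congrArg _ h1.symm)
  · exact (wordVal_lt t.2).trans_eq (congrArg _ h2.symm)

lemma tileOf_index {t : WordTile} (h : t.order = n) : tileOf n (index n t) = rect t := by
  obtain ⟨h1, h2, h3, h4⟩ := index_spec h
  rw [tileOf, h3, h4, h2, h1, rect]

lemma index_injective {t u : WordTile} (ht : t.order = n) (hu : u.order = n)
    (h : index n t = index n u) : t = u := by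
  obtain ⟨h1, h2, h3, h4⟩ := index_spec ht
  obtain ⟨k1, k2, k3, k4⟩ := index_spec hu
  rw [h] at h1 h2 h3 h4
  exact Prod.ext (wordVal_injective (h1.symm.trans k1) (h3.symm.trans k3))
    (wordVal_injective (h2.symm.trans k2) (h4.symm.trans k4))

/-- The dyadic interval `[a/2^i, (a+1)/2^i]`. -/
def dyadicInterval (i a : ℕ) : Set ℝ := Set.Icc ((a : ℝ) / 2 ^ i) (((a : ℝ) + 1) / 2 ^ i)

lemma dyadicInterval_union (i a : ℕ) :
    dyadicInterval (i + 1) (2 * a) ∪ dyadicInterval (i + 1) (2 * a + 1) = dyadicInterval i a := by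
  have h2 : (0 : ℝ) < 2 ^ i := by positivity
  have e1 : ((2 * a : ℕ) : ℝ) / 2 ^ (i + 1) = a / 2 ^ i := by
    push_cast; field_simp; ring
  have e2 : (((2 * a + 1 : ℕ) : ℝ) + 1) / 2 ^ (i + 1) = (a + 1) / 2 ^ i := by
    push_cast; field_simp; ring
  have e3 : ((2 * a + 1 : ℕ) : ℝ) = ((2 * a : ℕ) : ℝ) + 1 := by push_cast; ring
  rw [dyadicInterval, dyadicInterval, dyadicInterval, e2, e3, Set.Icc_union_Icc_eq_Icc, e1]
  · gcongr; linarith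
  · rw [← e3, ← e2]; gcongr; linarith

lemma interior_dyadicInterval_inter (i a : ℕ) :
    interior (dyadicInterval i a) ∩ interior (dyadicInterval i (a + 1)) = ∅ := by
  simp only [dyadicInterval, interior_Icc]
  ext x
  simp only [Set.mem_inter_iff, Set.mem_Ioo, Set.mem_empty_iff_false, iff_false]
  push_cast
  rintro ⟨⟨-, h⟩, ⟨h', -⟩⟩
  exact lt_asymm h h'

lemma rect_eq_prod (t : WordTile) : rect t =
    dyadicInterval t.1.length (wordVal t.1) ×ˢ dyadicInterval t.2.length (wordVal t.2) := rfl

lemma rect_splitFst (x y : List Bool) : rect (false :: x, y) ∪ rect (true :: x, y) = rect (x, y) ∧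
    interior (rect (false :: x, y)) ∩ interior (rect (true :: x, y)) = ∅ := by
  simp only [rect_eq_prod, interior_prod_eq, List.length_cons, wordVal, Bool.toNat_false,
    Bool.toNat_true, add_zero]
  constructor
  · rw [← Set.union_prod, dyadicInterval_union]
  · rw [Set.prod_inter_prod, interior_dyadicInterval_inter, Set.empty_prod]

lemma rect_splitSnd (x y : List Bool) : rect (x, false :: y) ∪ rect (x, true :: y) = rect (x, y) ∧
    interior (rect (x, false :: y)) ∩ interior (rect (x, true :: y)) = ∅ := by
  simp only [rect_eq_prod, interior_prod_eq, List.length_cons, wordVal, Bool.toNat_false,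
    Bool.toNat_true, add_zero]
  constructor
  · rw [← Set.prod_union, dyadicInterval_union]
  · rw [Set.prod_inter_prod, interior_dyadicInterval_inter, Set.prod_empty]

lemma isTiling_union {F G : Set (Set (ℝ × ℝ))} {R₁ R₂ : Set (ℝ × ℝ)}
    (hF : IsTiling n F R₁) (hG : IsTiling n G R₂) (h : interior R₁ ∩ interior R₂ = ∅) :
    IsTiling n (F ∪ G) (R₁ ∪ R₂) := by
  obtain ⟨hF1, rfl, hF3⟩ := hF
  obtain ⟨hG1, rfl, hG3⟩ := hG
  refine ⟨fun t ht => ht.elim (hF1 t) (hG1 t), Set.sUnion_union F G, ?_⟩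
  have cross : ∀ s ∈ F, ∀ t ∈ G, interior s ∩ interior t = ∅ := fun s hs t ht =>
    Set.subset_eq_empty (Set.inter_subset_inter
      (interior_mono (Set.subset_sUnion_of_mem hs))
      (interior_mono (Set.subset_sUnion_of_mem ht))) h
  rintro s (hs | hs) t (ht | ht) hne
  · exact hF3 hs ht hne
  · exact cross s hs t ht
  · rw [Set.inter_comm]; exact cross t ht s hs
  · exact hG3 hs ht hne

/-- The word tiles of order `n` whose index belongs to `S`. -/
def Available (S : Finset (TileIndex n)) (t : WordTile) : Prop :=
  t.order = n ∧ index n t ∈ S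

lemma Good.exists_isTiling {S : Finset (TileIndex n)} {t : WordTile}
    (h : Good (Available S) t) :
    ∃ F : Set (Set (ℝ × ℝ)), (∀ t ∈ F, ∃ x ∈ S, t = tileOf n x) ∧ IsTiling n F (rect t) := by
  have glue : ∀ {R₁ R₂ R : Set (ℝ × ℝ)}, R₁ ∪ R₂ = R ∧ interior R₁ ∩ interior R₂ = ∅ →
      (∃ F : Set (Set (ℝ × ℝ)), (∀ t ∈ F, ∃ x ∈ S, t = tileOf n x) ∧ IsTiling n F R₁) →
      (∃ F : Set (Set (ℝ × ℝ)), (∀ t ∈ F, ∃ x ∈ S, t = tileOf n x) ∧ IsTiling n F R₂) →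
      ∃ F : Set (Set (ℝ × ℝ)), (∀ t ∈ F, ∃ x ∈ S, t = tileOf n x) ∧ IsTiling n F R := by
    rintro R₁ R₂ R ⟨rfl, hR⟩ ⟨F, hF, hFt⟩ ⟨G, hG, hGt⟩
    exact ⟨F ∪ G, fun t ht => ht.elim (hF t) (hG t), isTiling_union hFt hGt hR⟩
  induction h with
  | base h =>
    rename_i t
    refine ⟨{rect t}, ?_, ?_, by simp, Set.pairwise_singleton _ _⟩
    · rintro _ rfl
      exact ⟨_, h.2, (tileOf_index h.1).symm⟩
    · rintro _ rfl
      exact ⟨_, _, _, _, h.1, wordVal_lt t.1, wordVal_lt t.2, rfl⟩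
  | splitFst _ ih => exact glue (rect_splitFst _ _) (ih false) (ih true)
  | splitSnd _ ih => exact glue (rect_splitSnd _ _) (ih false) (ih true)

lemma tileableSquare_of_good {S : Finset (TileIndex n)} (h : Good (Available S) ([], [])) :
    TileableSquare n S := by
  have hr : rect ([], []) = unitSquare := by simp [rect, dyadicTile, unitSquare, wordVal]
  simpa only [TileableSquare, hr] using h.exists_isTiling

/-- `MissedBy S s`: the tiles of the chain forest `s` are distinct, of order `n`, and none of
them belongs to `S`. -/
def MissedBy (S : Finset (TileIndex n)) (s : WordTile × List (WordTile × Bool)) : Prop :=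
  (s.1 :: s.2.map Prod.fst).Nodup ∧
    ∀ u ∈ s.1 :: s.2.map Prod.fst, u.order = n ∧ index n u ∉ S

lemma exists_missedBy {S : Finset (TileIndex n)} (h : ¬ TileableSquare n S) :
    ∃ s ∈ forests n, MissedBy S s := by
  have hav : ∀ t, Available S t → t.order = n := fun t ht => ht.1
  have hbad : ¬ Good (Available S) ([], []) := fun hg => h (tileableSquare_of_good hg)
  obtain ⟨s, hs, hval, hord⟩ := exists_valid_mem_forests hav hbad n
  refine ⟨s, hs, hval.nodup hord, fun u hu => ⟨hord u hu, fun hm => ?_⟩⟩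
  refine (?_ : ¬ Good (Available S) u) (.base ⟨hord u hu, hm⟩)
  rcases List.mem_cons.1 hu with rfl | hu
  · exact hval.not_good
  · exact hval.not_good_of_mem u hu

end WordTile

lemma card_tileIndex (n : ℕ) : Fintype.card (TileIndex n) = (n + 1) * 2 ^ n := by
  have h : ∀ i : Fin (n + 1), 2 ^ (i : ℕ) * 2 ^ (n - (i : ℕ)) = 2 ^ n := fun i => by
    rw [← pow_add, Nat.add_sub_cancel' (Nat.lt_succ_iff.1 i.2)]
  simp [TileIndex, h]

open Classical in
lemma Pr_add_Pr_not (n : ℕ) (p : ℝ) (E : Finset (TileIndex n) → Prop) :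
    Pr n p E + Pr n p (fun S => ¬ E S) = 1 := by
  rw [Pr, Pr, ← Finset.sum_add_distrib]
  have h := Fintype.sum_pow_mul_eq_add_pow (TileIndex n) p (1 - p)
  rw [card_tileIndex, add_sub_cancel, one_pow] at h
  refine (Finset.sum_congr rfl fun S _ => ?_).trans h
  by_cases hE : E S <;> simp [hE]

lemma Pr_summand_nonneg {n : ℕ} {p : ℝ} (hp : p ∈ Set.Icc (0 : ℝ) 1)
    (S : Finset (TileIndex n)) :
    0 ≤ p ^ S.card * (1 - p) ^ ((n + 1) * 2 ^ n - S.card) :=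
  mul_nonneg (pow_nonneg hp.1 _) (pow_nonneg (sub_nonneg.2 hp.2) _)

lemma Pr_mono {n : ℕ} {p : ℝ} (hp : p ∈ Set.Icc (0 : ℝ) 1)
    {E E' : Finset (TileIndex n) → Prop} (h : ∀ S, E S → E' S) :
    Pr n p E ≤ Pr n p E' := by
  refine Finset.sum_le_sum fun S _ => ?_
  by_cases hE : E S
  · simp [hE, h S hE]
  · rw [if_neg hE]
    split_ifs
    exacts [Pr_summand_nonneg hp S, le_rfl]

lemma Pr_or_le {n : ℕ} {p : ℝ} (hp : p ∈ Set.Icc (0 : ℝ) 1)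
    (E E' : Finset (TileIndex n) → Prop) :
    Pr n p (fun S => E S ∨ E' S) ≤ Pr n p E + Pr n p E' := by
  rw [Pr, Pr, Pr, ← Finset.sum_add_distrib]
  refine Finset.sum_le_sum fun S _ => ?_
  have := Pr_summand_nonneg hp S
  by_cases hE : E S <;> by_cases hE' : E' S <;> simp [hE, hE', this]

lemma Pr_exists_mem_le {n : ℕ} {p : ℝ} (hp : p ∈ Set.Icc (0 : ℝ) 1)
    {α : Type*} (l : List α) (P : α → Finset (TileIndex n) → Prop)
    (c : α → ℝ) (h : ∀ a ∈ l, Pr n p (P a) ≤ c a) :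
    Pr n p (fun S => ∃ a ∈ l, P a S) ≤ (l.map c).sum := by
  induction l with
  | nil => simp [Pr]
  | cons a l ih =>
    simp only [List.mem_cons, exists_eq_or_imp, List.map_cons, List.sum_cons]
    exact (Pr_or_le hp _ _).trans
      (add_le_add (h a (by simp)) (ih fun b hb => h b (List.mem_cons_of_mem _ hb)))

lemma Pr_disjoint (n : ℕ) (p : ℝ) (U : Finset (TileIndex n)) :
    Pr n p (fun S => Disjoint S U) = (1 - p) ^ U.card := by
  classical
  have h := Finset.sum_pow_mul_eq_add_pow p (1 - p) Uᶜ
  rw [add_sub_cancel, one_pow] at h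
  have hc := Finset.card_add_card_compl U
  rw [card_tileIndex] at hc
  calc Pr n p (fun S => Disjoint S U)
      = ∑ S ∈ Uᶜ.powerset, p ^ S.card * (1 - p) ^ ((n + 1) * 2 ^ n - S.card) := ?_
    _ = (1 - p) ^ U.card *
        ∑ S ∈ Uᶜ.powerset, p ^ S.card * (1 - p) ^ (Uᶜ.card - S.card) := ?_
    _ = (1 - p) ^ U.card := by rw [h, mul_one]
  · have hU : Uᶜ.powerset = Finset.univ.filter fun S => Disjoint S U := by
      ext S
      simp [Finset.subset_compl_iff_disjoint_right]
    rw [hU, Finset.sum_filter, Pr]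
    exact Finset.sum_congr rfl fun S _ => by congr
  · rw [Finset.mul_sum]
    refine Finset.sum_congr rfl fun S hS => ?_
    have := Finset.card_le_card (Finset.mem_powerset.1 hS)
    rw [mul_left_comm, ← pow_add]
    congr 2
    omega

open WordTile in
lemma Pr_missedBy_le {n : ℕ} {p : ℝ} (hp : p ∈ Set.Icc (0 : ℝ) 1)
    (s : WordTile × List (WordTile × Bool)) :
    Pr n p (fun S => MissedBy S s) ≤ (1 - p) * weight (1 - p) (1 - p) s.2 := by
  classical
  rw [weight_self, ← pow_succ']
  by_cases hs : (s.1 :: s.2.map Prod.fst).Nodup ∧ ∀ u ∈ s.1 :: s.2.map Prod.fst, u.order = n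
  · obtain ⟨hnd, hord⟩ := hs
    have hcard : ((s.1 :: s.2.map Prod.fst).toFinset.image (index n)).card = s.2.length + 1 := by
      rw [Finset.card_image_of_injOn, List.toFinset_card_of_nodup hnd]
      · simp
      · intro u hu v hv huv
        exact index_injective (hord u (List.mem_toFinset.1 hu)) (hord v (List.mem_toFinset.1 hv))
          huv
    rw [← hcard, ← Pr_disjoint]
    refine Pr_mono hp fun S hS => Finset.disjoint_right.2 fun i hi => ?_
    obtain ⟨u, hu, rfl⟩ := Finset.mem_image.1 hi
    exact (hS.2 u (List.mem_toFinset.1 hu)).2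
  · have h0 : Pr n p (fun S => MissedBy S s) = 0 := Finset.sum_eq_zero fun S _ =>
      if_neg fun hm => hs ⟨hm.1, fun u hu => (hm.2 u hu).1⟩
    rw [h0]
    exact pow_nonneg (sub_nonneg.2 hp.2) _

/-- `1 - T_n(p) ≤ f_n(1-p, 1-p)`. -/
theorem one_sub_T_le_fpoly (n : ℕ) (p : ℝ) (hp : p ∈ Set.Icc (0 : ℝ) 1) :
    1 - T n p ≤ fpoly n (1 - p) (1 - p) := by
  have h := Pr_add_Pr_not n p (TileableSquare n)
  calc 1 - T n p = Pr n p (fun S => ¬ TileableSquare n S) := by rw [T]; linarith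
    _ ≤ Pr n p (fun S => ∃ s ∈ WordTile.forests n, WordTile.MissedBy S s) :=
      Pr_mono hp fun S hS => WordTile.exists_missedBy hS
    _ ≤ _ := Pr_exists_mem_le hp _ _ _ fun s _ => Pr_missedBy_le hp s
    _ = fpoly n (1 - p) (1 - p) := WordTile.sum_weight_forests n _ _

end
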